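/- Assume K is stable. Let (w_i)_{i∈ℕ} ⊆ L converge to w ∈ L, and let (v_i)_{i∈ℕ} ⊆ K converge to v ∈ K with f(v_i) = w_i for all i and v ∈ ri(f|_K^{-1}(w)). Let G be the face of L with w ∈ ri(G) and for each i let G_i be the face of L with w_i ∈ ri(G_i). Then for every set O ⊆ L open in L with O ∩ G ≠ ∅ there exists N ∈ ℕ such that O ∩ G_i ≠ ∅ for all i ≥ N. -/

import Mathlib

open Set Filter Topology

/-- A face of a convex set `C`: a convex subset `F ⊆ C` such that any segment of `C` whose
relative interior meets `F` lies in `F` (i.e. `F` is convex and extreme in `C`). -/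
def IsFaceOf {Y : Type*} [AddCommGroup Y] [Module ℝ Y] (C F : Set Y) : Prop :=
  Convex ℝ F ∧ IsExtreme ℝ C F

/-- A convex body `K` is stable if the midpoint map `K × K → K` is open
(with respect to the subspace topologies). -/
def IsStableConvexBody {X : Type*} [NormedAddCommGroup X] [NormedSpace ℝ X] (K : Set X) : Prop :=
  ∀ p ∈ K ×ˢ K, ∀ N ⊆ K ×ˢ K, N ∈ nhdsWithin p (K ×ˢ K) →
    (fun q : X × X => midpoint ℝ q.1 q.2) '' N ∈ nhdsWithin (midpoint ℝ p.1 p.2) K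

/-- A point of the relative interior can be pushed past, away from any other point of the set. -/
theorem exists_mem_openSegment_of_mem_intrinsicInterior {E : Type*} [NormedAddCommGroup E]
    [NormedSpace ℝ E] {s : Set E} {x y : E} (hx : x ∈ intrinsicInterior ℝ s) (hy : y ∈ s) :
    ∃ z ∈ s, x ∈ openSegment ℝ y z := by
  obtain ⟨x', hx', rfl⟩ := mem_intrinsicInterior.1 hx
  let g : ℝ → affineSpan ℝ s := fun t =>
    ⟨AffineMap.lineMap y (x' : E) t, AffineMap.lineMap_mem t (subset_affineSpan ℝ s hy) x'.2⟩
  have hg : Continuous g :=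
    Continuous.subtype_mk (AffineMap.lineMap_continuous (p := y) (q := (x' : E))) _
  have hg1 : g 1 = x' := Subtype.ext (by simp [g])
  have hmem : ∀ᶠ t in 𝓝 (1 : ℝ), ((g t : affineSpan ℝ s) : E) ∈ s :=
    hg.continuousAt.eventually (by rw [hg1]; exact mem_interior_iff_mem_nhds.1 hx')
  obtain ⟨t, hts, ht⟩ := ((hmem.filter_mono nhdsWithin_le_nhds).and
    (self_mem_nhdsWithin : Ioi (1 : ℝ) ∈ 𝓝[>] 1)).exists
  have ht1 : (1 : ℝ) < t := ht
  have ht0 : 0 < t := by linarith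
  refine ⟨_, hts, 1 - t⁻¹, t⁻¹, by simpa using inv_lt_one_of_one_lt₀ ht1, inv_pos.2 ht0,
    by ring, ?_⟩
  simp only [g, AffineMap.lineMap_apply_module]
  match_scalars <;> field_simp
  ring

/-- Nested proper convex combinations in a convex set can be flattened. -/
theorem Convex.exists_mem_openSegment_trans {E : Type*} [AddCommGroup E] [Module ℝ E]
    {K : Set E} (hK : Convex ℝ K) {x y z u v : E} (hy : y ∈ K) (hz : z ∈ K)
    (hu : u ∈ openSegment ℝ x z) (hv : v ∈ openSegment ℝ u y) :
    ∃ y' ∈ K, v ∈ openSegment ℝ x y' := by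
  obtain ⟨c, d, hc, hd, hcd, rfl⟩ := hu
  obtain ⟨a, b, ha, hb, hab, rfl⟩ := hv
  have hs : 0 < a * d + b := by positivity
  refine ⟨(a * d / (a * d + b)) • z + (b / (a * d + b)) • y,
    hK hz hy (by positivity) (by positivity) (by field_simp), a * c, a * d + b,
    by positivity, hs, by linear_combination a * hcd + hab, ?_⟩
  match_scalars <;> field_simp

/-- In a stable convex body, the points lying on open segments with one end in a given
neighbourhood of `x` form a neighbourhood of each proper convex combination of `x` with another
point of the body. -/
theorem IsStableConvexBody.eventually_mem_openSegment {X : Type*} [NormedAddCommGroup X]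
    [NormedSpace ℝ X] {K : Set X} (hstable : IsStableConvexBody K) (hK : Convex ℝ K)
    {p x y : X} (hx : x ∈ K) (hy : y ∈ K) (hp : p ∈ openSegment ℝ x y) {U : Set X}
    (hU : U ∈ 𝓝 x) :
    ∀ᶠ q in 𝓝[K] p, ∃ x' ∈ U ∩ K, ∃ y' ∈ K, q ∈ openSegment ℝ x' y' := by
  have midpoint_nhds {u z : X} (hu : u ∈ K) (hz : z ∈ K) {V : Set X} (hV : V ∈ 𝓝[K] u) :
      ∀ᶠ q in 𝓝[K] midpoint ℝ u z, ∃ u' ∈ V ∩ K, ∃ z' ∈ K, q ∈ openSegment ℝ u' z' := by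
    have hN : (V ∩ K) ×ˢ K ∈ 𝓝[K ×ˢ K] (u, z) := by
      rw [nhdsWithin_prod_eq]
      exact prod_mem_prod (inter_mem hV self_mem_nhdsWithin) self_mem_nhdsWithin
    filter_upwards [hstable (u, z) ⟨hu, hz⟩ _ (prod_mono inter_subset_right subset_rfl) hN]
    rintro _ ⟨⟨u', z'⟩, ⟨hu', hz'⟩, rfl⟩
    exact ⟨u', hu', z', hz', midpoint_mem_openSegment u' z'⟩
  have dyadic (n : ℕ) : ∀ a : ℝ, (1 / 2) ^ n ≤ a → a ≤ 1 →
      ∀ᶠ q in 𝓝[K] (a • x + (1 - a) • y), ∃ x' ∈ U ∩ K, ∃ y' ∈ K, q ∈ openSegment ℝ x' y' := by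
    induction n with
    | zero =>
      intro a ha ha1
      obtain rfl : a = 1 := le_antisymm ha1 (by simpa using ha)
      filter_upwards [mem_nhdsWithin_of_mem_nhds (t := K) (s := U) (by simpa using hU),
        self_mem_nhdsWithin] with q hqU hqK
      exact ⟨q, ⟨hqU, hqK⟩, q, hqK, by simp⟩
    | succ n ih =>
      intro a ha ha1
      have ha0 : 0 < a := lt_of_lt_of_le (by positivity) ha
      rcases le_total (1 / 2) a with h | h
      · have hz : (2 * a - 1) • x + (2 - 2 * a) • y ∈ K :=
          hK hx hy (by linarith) (by linarith) (by ring)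
        convert midpoint_nhds hx hz (mem_nhdsWithin_of_mem_nhds hU) using 2
        rw [midpoint_eq_smul_add, invOf_eq_inv]
        module
      · have hu : (2 * a) • x + (1 - 2 * a) • y ∈ K :=
          hK hx hy (by linarith) (by linarith) (by ring)
        have key := midpoint_nhds hu hy (ih (2 * a) (by rw [pow_succ] at ha; linarith) (by linarith))
        have hmid : midpoint ℝ ((2 * a) • x + (1 - 2 * a) • y) y = a • x + (1 - a) • y := by
          rw [midpoint_eq_smul_add, invOf_eq_inv]
          module
        rw [hmid] at key
        filter_upwards [key]
        rintro q ⟨u', ⟨⟨x', hx', z', hz', hu'⟩, -⟩, y', hy', hq⟩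
        exact ⟨x', hx', hK.exists_mem_openSegment_trans hy' hz' hu' hq⟩
  obtain ⟨a, b, ha, hb, hab, rfl⟩ := hp
  obtain rfl : b = 1 - a := by linarith
  obtain ⟨n, hn⟩ := exists_pow_lt_of_lt_one ha (by norm_num : (1 / 2 : ℝ) < 1)
  exact dyadic n a hn.le (by linarith)

theorem face_function_lsc_along_sequence {X Y : Type*}
    [NormedAddCommGroup X] [NormedSpace ℝ X] [FiniteDimensional ℝ X]
    [NormedAddCommGroup Y] [NormedSpace ℝ Y] [FiniteDimensional ℝ Y]
    (K : Set X) (hKne : K.Nonempty) (hKcomp : IsCompact K) (hKconv : Convex ℝ K)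
    (hstable : IsStableConvexBody K)
    (f : X →ₗ[ℝ] Y) (L : Set Y) (hL : L = f '' K)
    (w : ℕ → Y) (wlim : Y) (hwL : ∀ i, w i ∈ L) (hwlimL : wlim ∈ L)
    (hwconv : Tendsto w atTop (nhds wlim))
    (v : ℕ → X) (vlim : X) (hvK : ∀ i, v i ∈ K) (hfv : ∀ i, f (v i) = w i)
    (hvconv : Tendsto v atTop (nhds vlim))
    (hvlim : vlim ∈ intrinsicInterior ℝ {x ∈ K | f x = wlim})
    (G : Set Y) (hG : IsFaceOf L G) (hwG : wlim ∈ intrinsicInterior ℝ G)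
    (Gi : ℕ → Set Y) (hGi : ∀ i, IsFaceOf L (Gi i)) (hwGi : ∀ i, w i ∈ intrinsicInterior ℝ (Gi i)) :
    ∀ O : Set Y, O ⊆ L → (∃ U : Set Y, IsOpen U ∧ O = U ∩ L) → (O ∩ G).Nonempty →
      ∃ N : ℕ, ∀ i ≥ N, (O ∩ Gi i).Nonempty := by
  rintro O - ⟨U, hU, rfl⟩ ⟨g, ⟨hgU, -⟩, hgG⟩
  subst hL
  obtain ⟨h, hhG, hwgh⟩ := exists_mem_openSegment_of_mem_intrinsicInterior hwG hgG
  obtain ⟨x, hxK, rfl⟩ := hG.2.subset hgG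
  obtain ⟨y, hyK, rfl⟩ := hG.2.subset hhG
  obtain ⟨z, hz, hfz⟩ : ∃ z ∈ openSegment ℝ x y, f z = wlim := by
    exact (image_openSegment ℝ f.toAffineMap x y).superset hwgh
  obtain ⟨z', ⟨hz'K, -⟩, hv⟩ := exists_mem_openSegment_of_mem_intrinsicInterior hvlim
    (show z ∈ {x ∈ K | f x = wlim} from ⟨hKconv.openSegment_subset hxK hyK hz, hfz⟩)
  obtain ⟨y', hy'K, hv'⟩ := hKconv.exists_mem_openSegment_trans hz'K hyK hz hv
  have hfc : Continuous f := f.continuous_of_finiteDimensional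
  have hev := hstable.eventually_mem_openSegment hKconv hxK hy'K hv'
    ((hU.preimage hfc).mem_nhds hgU)
  have hvt : Tendsto v atTop (𝓝[K] vlim) :=
    tendsto_nhdsWithin_iff.2 ⟨hvconv, Eventually.of_forall hvK⟩
  obtain ⟨N, hN⟩ := eventually_atTop.1 (hvt.eventually hev)
  refine ⟨N, fun i hi => ?_⟩
  obtain ⟨x', ⟨hx'U, hx'K⟩, y'', hy''K, hseg⟩ := hN i hi
  have hwseg : w i ∈ openSegment ℝ (f x') (f y'') := by
    rw [← hfv i]
    exact (image_openSegment ℝ f.toAffineMap x' y'').subset (mem_image_of_mem _ hseg)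
  exact ⟨f x', ⟨hx'U, mem_image_of_mem f hx'K⟩,
    (hGi i).2.left_mem_of_mem_openSegment (mem_image_of_mem f hx'K) (mem_image_of_mem f hy''K)
      (intrinsicInterior_subset (hwGi i)) hwseg⟩
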